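/- Let E : 0 → B →(ι) C →(ρ) G → 0 and Ẽ : 0 → B̃ →(ι̃) C̃ →(ρ̃) G̃ → 0 be short exact sequences in an abelian category 𝒜 in which Ext-groups exist (e.g. 𝒜 has enough injectives), with extension classes [E] ∈ Ext¹_𝒜(G, B) and [Ẽ] ∈ Ext¹_𝒜(G̃, B̃). Let N denote the abelian group of morphisms of short exact sequences from E to Ẽ, i.e. triples (f_B, f_C, f_G) making both squares commute. Then the sequence of abelian groups 0 → Hom_𝒜(G, B̃) → N → Hom_𝒜(B, B̃) ⊕ Hom_𝒜(G, G̃) → Ext¹_𝒜(G, B̃) is exact, where the first map sends φ to (0, ι̃ ∘ φ ∘ ρ, 0), the second sends (f_B, f_C, f_G) to (f_B, f_G), and the third sends (f_B, f_G) to (f_B)_*([E]) − (f_G)^*([Ẽ]). -/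

import Mathlib

open CategoryTheory CategoryTheory.Abelian

universe w v u

/-- The abelian group `N` of morphisms of short exact sequences `E → E'`:
triples `(f_B, f_C, f_G)` making both squares commute. -/
def sesHomGroup {𝒜 : Type u} [Category.{v} 𝒜] [Abelian 𝒜] (E E' : ShortComplex 𝒜) :
    AddSubgroup ((E.X₁ ⟶ E'.X₁) × (E.X₂ ⟶ E'.X₂) × (E.X₃ ⟶ E'.X₃)) where
  carrier := {t | E.f ≫ t.2.1 = t.1 ≫ E'.f ∧ t.2.1 ≫ E'.g = E.g ≫ t.2.2}
  add_mem' := by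
    intro a b ha hb
    exact ⟨by simp only [Prod.fst_add, Prod.snd_add, Preadditive.comp_add,
        Preadditive.add_comp, ha.1, hb.1],
      by simp only [Prod.fst_add, Prod.snd_add, Preadditive.comp_add,
        Preadditive.add_comp, ha.2, hb.2]⟩
  zero_mem' := ⟨by simp, by simp⟩
  neg_mem' := by
    intro a ha
    exact ⟨by simp only [Prod.fst_neg, Prod.snd_neg, Preadditive.comp_neg,
        Preadditive.neg_comp, ha.1],
      by simp only [Prod.fst_neg, Prod.snd_neg, Preadditive.comp_neg,
        Preadditive.neg_comp, ha.2]⟩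

/-- The first map of the four-term sequence, sending `φ : G ⟶ B̃` to the morphism
`(0, ι̃ ∘ φ ∘ ρ, 0)` of short exact sequences. -/
def sesHomOfHom {𝒜 : Type u} [Category.{v} 𝒜] [Abelian 𝒜] (E E' : ShortComplex 𝒜)
    (φ : E.X₃ ⟶ E'.X₁) : sesHomGroup E E' :=
  ⟨(0, E.g ≫ φ ≫ E'.f, 0),
    by simp [reassoc_of% E.zero], by simp [E'.zero]⟩

/-- A pair `(a, b)` with `a_* [E] = b^* [E']` extends to a morphism of short exact sequences. -/
lemma exists_middle_hom_of_extClass_comp_eq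
    {𝒜 : Type u} [Category.{v} 𝒜] [Abelian 𝒜] [HasExt.{w} 𝒜]
    {E E' : ShortComplex 𝒜} (hE : E.ShortExact) (hE' : E'.ShortExact)
    (a : E.X₁ ⟶ E'.X₁) (b : E.X₃ ⟶ E'.X₃)
    (h : hE.extClass.comp (Ext.mk₀ a) (add_zero 1) =
      (Ext.mk₀ b).comp hE'.extClass (zero_add 1)) :
    ∃ c : E.X₂ ⟶ E'.X₂, E.f ≫ c = a ≫ E'.f ∧ c ≫ E'.g = E.g ≫ b := by
  have := hE'.mono_f
  obtain ⟨c, hc⟩ : ∃ c : E.X₂ ⟶ E'.X₂, c ≫ E'.g = E.g ≫ b := by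
    obtain ⟨x, hx⟩ := Ext.covariant_sequence_exact₃ E.X₂ hE' (Ext.mk₀ (E.g ≫ b)) (zero_add 1)
      (by rw [← Ext.mk₀_comp_mk₀_assoc, ← h, hE.comp_extClass_assoc])
    obtain ⟨c, rfl⟩ := (Ext.mk₀_bijective _ _).2 x
    exact ⟨c, (Ext.mk₀_bijective _ _).1 (by rw [← hx, Ext.mk₀_comp_mk₀])⟩
  have hc₀ : (E.f ≫ c) ≫ E'.g = 0 := by simp [hc, reassoc_of% E.zero]
  let a' := hE'.exact.lift (E.f ≫ c) hc₀
  have ha' : a' ≫ E'.f = E.f ≫ c := hE'.exact.lift_f _ hc₀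
  have nat : hE.extClass.comp (Ext.mk₀ a') (add_zero 1) =
      (Ext.mk₀ b).comp hE'.extClass (zero_add 1) :=
    ShortComplex.ShortExact.extClass_naturality hE hE'
      { τ₁ := a', τ₂ := c, τ₃ := b, comm₁₂ := ha', comm₂₃ := hc }
  obtain ⟨d, hd⟩ : ∃ d : E.X₂ ⟶ E'.X₁, E.f ≫ d = a - a' := by
    obtain ⟨x, hx⟩ := Ext.contravariant_sequence_exact₁ hE E'.X₁ (Ext.mk₀ (a - a')) (add_zero 1)
      (by
        rw [sub_eq_add_neg, Ext.mk₀_add, Ext.mk₀_neg, Ext.comp_add, Ext.comp_neg, h, nat,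
          add_neg_cancel])
    obtain ⟨d, rfl⟩ := (Ext.mk₀_bijective _ _).2 x
    exact ⟨d, (Ext.mk₀_bijective _ _).1 (by rw [← hx, Ext.mk₀_comp_mk₀])⟩
  refine ⟨c + d ≫ E'.f, ?_, by simp [hc]⟩
  rw [Preadditive.comp_add, reassoc_of% hd, Preadditive.sub_comp, ha']
  abel

/-- For short exact sequences `E : 0 → B → C → G → 0` and
`Ẽ : 0 → B̃ → C̃ → G̃ → 0` in an abelian category with Ext-groups, with `N` the group of
morphisms of short exact sequences `E → Ẽ`, the sequence of abelian groups
`0 → Hom(G, B̃) → N → Hom(B, B̃) ⊕ Hom(G, G̃) → Ext¹(G, B̃)`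
is exact, where the first map sends `φ` to `(0, ι̃ ∘ φ ∘ ρ, 0)`, the second sends
`(f_B, f_C, f_G)` to `(f_B, f_G)` and the third sends `(f_B, f_G)` to
`(f_B)_*([E]) − (f_G)^*([Ẽ])`. -/
theorem sesHom_four_term_exact_sequence
    {𝒜 : Type u} [Category.{v} 𝒜] [Abelian 𝒜] [HasExt.{w} 𝒜]
    (E E' : ShortComplex 𝒜) (hE : E.ShortExact) (hE' : E'.ShortExact) :
    Function.Injective (sesHomOfHom E E') ∧
    Function.Exact (sesHomOfHom E E')
      (fun t : sesHomGroup E E' => (t.1.1, t.1.2.2)) ∧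
    Function.Exact (fun t : sesHomGroup E E' => (t.1.1, t.1.2.2))
      (fun p : (E.X₁ ⟶ E'.X₁) × (E.X₃ ⟶ E'.X₃) =>
        hE.extClass.comp (Ext.mk₀ p.1) (add_zero 1)
          - (Ext.mk₀ p.2).comp hE'.extClass (zero_add 1)) := by
  have := hE.epi_g
  have := hE'.mono_f
  refine ⟨fun φ ψ h ↦ ?_, ?_, ?_⟩
  · have h₂ : E.g ≫ φ ≫ E'.f = E.g ≫ ψ ≫ E'.f := congrArg (fun t ↦ t.1.2.1) h
    rwa [cancel_epi, cancel_mono] at h₂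
  · rintro ⟨⟨a, c, b⟩, h₁, h₂⟩
    constructor
    · intro h
      obtain ⟨rfl, rfl⟩ : a = 0 ∧ b = 0 := Prod.mk.inj h
      have h₁' : E.f ≫ c = 0 := by simpa using h₁
      have h₂' : c ≫ E'.g = 0 := by simpa using h₂
      have hl : hE'.exact.lift c h₂' ≫ E'.f = c := hE'.exact.lift_f _ _
      have hf : E.f ≫ hE'.exact.lift c h₂' = 0 := by
        rw [← cancel_mono E'.f, Category.assoc, hl, h₁', Limits.zero_comp]
      refine ⟨hE.exact.desc _ hf, Subtype.ext (Prod.ext rfl (Prod.ext ?_ rfl))⟩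
      change E.g ≫ hE.exact.desc _ hf ≫ E'.f = c
      rw [hE.exact.g_desc_assoc, hl]
    · rintro ⟨φ, h⟩
      rw [← h]
      rfl
  · rintro ⟨a, b⟩
    refine sub_eq_zero.trans ⟨fun h ↦ ?_, ?_⟩
    · obtain ⟨c, h₁, h₂⟩ := exists_middle_hom_of_extClass_comp_eq hE hE' a b h
      exact ⟨⟨(a, c, b), h₁, h₂⟩, rfl⟩
    · rintro ⟨⟨⟨a', c, b'⟩, h₁, h₂⟩, h⟩
      obtain ⟨rfl, rfl⟩ : a' = a ∧ b' = b := Prod.mk.inj h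
      exact ShortComplex.ShortExact.extClass_naturality hE hE'
        { τ₁ := a', τ₂ := c, τ₃ := b', comm₁₂ := h₁.symm, comm₂₃ := h₂ }
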